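/- (Poincaré function for projective connections on an n-dimensional manifold, n ≥ 3.) Let n ≥ 3 and define h_0 = 0, h_1 = (1/3)·n^2·(n^2−7), h_2 = (n/24)·(n−2)·(5n^3 + 16n^2 + 15n + 12), and h_k = (n/2)·(n−1)·(n+2)·C(n+k−1, k) − n·C(n+k+1, k+2) for k ≥ 3. Then for every real z with 0 < |z| < 1, ∑_{k=0}^∞ h_k z^k = (n/(1−z)^n)·( C(n+1,2) − (1 + z^2)/z^2 ) − n·( z^2 + nz − 1 − (nz + 1)/z^2 ). -/

import Mathlib

theorem hasSum_choose_add_two_mul_pow (m : ℕ) {z : ℝ} (hz0 : z ≠ 0) (hz1 : |z| < 1) :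
    HasSum (fun k : ℕ => ((k + 2 + m).choose m : ℝ) * z ^ k)
      ((1 / (1 - z) ^ (m + 1) - (1 + (m + 1) * z)) / z ^ 2) := by
  have hshift := (hasSum_nat_add_iff' 2).2
    (hasSum_choose_mul_geometric_of_norm_lt_one (𝕜 := ℝ) m (r := z) (by simpa using hz1))
  convert! hshift.div_const (z ^ 2) using 1
  · ext k
    field_simp
    ring
  · simp [Finset.sum_range_succ, add_comm 1 m]

theorem cast_choose_three_add (m : ℕ) :
    ((m + 3).choose m : ℝ) = (m + 3) * (m + 2) * (m + 1) / 6 := by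
  induction m with
  | zero => norm_num
  | succ m ih =>
    have h2 : ((m + 3).choose (m + 1) : ℝ) = (m + 3) * (m + 2) / 2 := by
      rw [← Nat.choose_symm_of_eq_add (show m + 3 = 2 + (m + 1) by ring), Nat.cast_choose_two]
      push_cast; ring
    rw [show m + 1 + 3 = (m + 3) + 1 by ring, Nat.choose_succ_succ]
    push_cast
    rw [ih, h2]; ring

theorem cast_choose_four_add (m : ℕ) :
    ((m + 4).choose m : ℝ) = (m + 4) * (m + 3) * (m + 2) * (m + 1) / 24 := by
  induction m with
  | zero => norm_num
  | succ m ih =>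
    have h3 := cast_choose_three_add (m + 1)
    rw [show m + 1 + 4 = (m + 4) + 1 by ring, Nat.choose_succ_succ]
    rw [show m + 1 + 3 = m + 4 by ring] at h3
    push_cast at h3 ⊢
    rw [ih, h3]; ring

theorem cast_choose_two_add (m : ℕ) :
    ((m + 2).choose m : ℝ) = (m + 2) * (m + 1) / 2 := by
  rw [← Nat.choose_symm_of_eq_add (show m + 2 = 2 + m by ring), Nat.cast_choose_two]
  push_cast; ring

/-- Poincaré function for projective connections on an n-dimensional manifold, n ≥ 3. -/
theorem poincare_projective_connections (n : ℕ) (hn : 3 ≤ n) (h : ℕ → ℝ)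
    (h_0 : h 0 = 0)
    (h_1 : h 1 = (1 / 3) * (n : ℝ) ^ 2 * ((n : ℝ) ^ 2 - 7))
    (h_2 : h 2 = ((n : ℝ) / 24) * ((n : ℝ) - 2)
      * (5 * (n : ℝ) ^ 3 + 16 * (n : ℝ) ^ 2 + 15 * (n : ℝ) + 12))
    (h_ge3 : ∀ k, 3 ≤ k → h k = ((n : ℝ) / 2) * ((n : ℝ) - 1) * ((n : ℝ) + 2)
      * ((n + k - 1).choose k : ℝ) - (n : ℝ) * ((n + k + 1).choose (k + 2) : ℝ))
    (z : ℝ) (hz0 : 0 < |z|) (hz1 : |z| < 1) :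
    HasSum (fun k : ℕ => h k * z ^ k)
      (((n : ℝ) / (1 - z) ^ n) * (((n + 1).choose 2 : ℝ) - (1 + z ^ 2) / z ^ 2)
        - (n : ℝ) * (z ^ 2 + (n : ℝ) * z - 1 - ((n : ℝ) * z + 1) / z ^ 2)) := by
  have hz : z ≠ 0 := abs_pos.1 hz0
  have h1z : 1 - z ≠ 0 := by
    have := (abs_lt.1 hz1).2
    linarith
  obtain ⟨m, rfl⟩ : ∃ m, n = m + 1 := ⟨n - 1, by omega⟩
  have hgeom := (hasSum_choose_mul_geometric_of_norm_lt_one (𝕜 := ℝ) m (r := z)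
    (by simpa using hz1)).mul_left (((m : ℝ) + 1) / 2 * m * (m + 3))
  have hshift := (hasSum_choose_add_two_mul_pow m hz hz1).mul_left ((m : ℝ) + 1)
  have hcorr := hasSum_sum_of_ne_finset_zero (L := .unconditional ℕ) (f := fun k : ℕ =>
    (if k = 0 then (m + 1 : ℝ) else if k = 1 then -(m + 1 : ℝ) ^ 2 else
      if k = 2 then -(m + 1 : ℝ) else 0) * z ^ k) (s := Finset.range 3) (by
    intro k hk
    have hk3 : 3 ≤ k := by simpa using hk
    simp [show k ≠ 0 by omega, show k ≠ 1 by omega, show k ≠ 2 by omega])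
  convert! (hgeom.sub hshift).add hcorr using 1
  · ext k
    match k with
    | 0 =>
      simp only [zero_add, Nat.choose_self, add_comm 2 m, cast_choose_two_add, h_0]
      norm_num
      ring
    | 1 =>
      simp only [h_1, show 1 + 2 + m = m + 3 by ring, cast_choose_three_add, add_comm 1 m,
        Nat.choose_succ_self_right]
      norm_num
      ring
    | 2 =>
      simp only [h_2, show 2 + 2 + m = m + 4 by ring, cast_choose_four_add, add_comm 2 m,
        cast_choose_two_add]
      norm_num
      ring
    | k + 3 =>
      rw [h_ge3 (k + 3) (by omega), show m + 1 + (k + 3) - 1 = k + 3 + m by omega,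
        show m + 1 + (k + 3) + 1 = k + 3 + 2 + m by ring,
        Nat.choose_symm_add (a := k + 3) (b := m), Nat.choose_symm_add (a := k + 3 + 2) (b := m),
        if_neg (by omega), if_neg (by omega), if_neg (by omega)]
      push_cast
      ring
  · rw [Nat.cast_choose_two]
    simp [Finset.sum_range_succ]
    field_simp
    ring
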